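/- arXiv:2605.03284 — 4 statements merged into one kernel-verified Lean document; each statement's English description precedes it below -/
import Mathlib

section
/- Let p ≥ 5 be a prime such that p - 1 is a power of 2 and (p+1)/2 is a power of an odd prime. Then p = 5 or p = 17. -/
/-- Two powers of two differing by two are `2` and `4`. -/
theorem two_pow_eq_two_of_two_pow_add_two {a b : ℕ} (h : 2 ^ b = 2 ^ a + 2) : 2 ^ a = 2 := by
  rcases a with _ | _ | a
  · rcases b with _ | b
    · simp at h
    · rw [pow_succ] at h
      omega
  · norm_num
  · have ha : 0 < 2 ^ a := by positivity
    rcases b with _ | _ | b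
    all_goals
      simp only [pow_succ, pow_zero] at h
      omega

/-- The only solution of `3 ^ t = 2 ^ m + 1` with `m ≥ 3` has `3 ^ t = 9`. -/
theorem three_pow_eq_nine_of_eq_two_pow_add_one {t m : ℕ} (hm : 3 ≤ m)
    (h : 3 ^ t = 2 ^ m + 1) : 3 ^ t = 9 := by
  have h8 : 3 ^ t % 8 = 1 := by
    obtain ⟨c, hc⟩ := pow_dvd_pow 2 hm
    omega
  rcases Nat.even_or_odd' t with ⟨s, rfl | rfl⟩
  · have hs : 1 ≤ 3 ^ s := Nat.one_le_pow _ _ (by norm_num)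
    obtain ⟨x, hx⟩ := Nat.exists_eq_add_of_le hs
    have hsq : 3 ^ (2 * s) = (3 ^ s) ^ 2 := by rw [mul_comm, pow_mul]
    have hprod : x * (x + 2) = 2 ^ m := by
      rw [hsq, hx] at h
      linarith [h, show (1 + x) ^ 2 = x * (x + 2) + 1 by ring]
    obtain ⟨a, -, ha⟩ := (Nat.dvd_prime_pow Nat.prime_two).1 (Dvd.intro _ hprod)
    obtain ⟨b, -, hb⟩ := (Nat.dvd_prime_pow Nat.prime_two).1 (Dvd.intro_left _ hprod)
    have hx2 : x = 2 := ha.trans (two_pow_eq_two_of_two_pow_add_two (hb.symm.trans (by rw [← ha])))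
    rw [hsq, hx, hx2]
    norm_num
  · have h9 : 9 ^ s % 8 = 1 := by simp [Nat.pow_mod]
    rw [pow_succ, pow_mul] at h8
    norm_num at h8
    omega

theorem stmt_4 (p : ℕ) (hp : p.Prime) (h5 : 5 ≤ p)
    (h1 : ∃ k : ℕ, p - 1 = 2 ^ k)
    (h2 : ∃ q t : ℕ, q.Prime ∧ Odd q ∧ 1 ≤ t ∧ (p + 1) / 2 = q ^ t) :
    p = 5 ∨ p = 17 := by
  obtain ⟨k, hk⟩ := h1
  obtain ⟨q, t, hq, -, ht, hqt⟩ := h2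
  have four_pow_mod (i : ℕ) : 4 ^ i % 3 = 1 := by simp [Nat.pow_mod]
  rcases Nat.even_or_odd' k with ⟨j, rfl | rfl⟩
  · rcases j with _ | i
    · norm_num at hk
      omega
    have hp4 : 2 ^ (2 * (i + 1)) = 4 * 4 ^ i := by rw [pow_mul, pow_succ]; norm_num [mul_comm]
    have h4 := four_pow_mod i
    have hdvd : 3 ∣ q ^ t := by omega
    obtain rfl : 3 = q :=
      (Nat.prime_dvd_prime_iff_eq Nat.prime_three hq).1 (Nat.prime_three.dvd_of_dvd_pow hdvd)
    rcases i with _ | i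
    · left
      norm_num at hk
      omega
    · right
      have hm : 2 ^ (2 * (i + 1) + 1) = 2 * 4 ^ (i + 1) := by
        rw [pow_succ, pow_mul]; norm_num [mul_comm]
      have h9 := three_pow_eq_nine_of_eq_two_pow_add_one (t := t) (m := 2 * (i + 1) + 1)
        (by omega) (by omega)
      omega
  · have hp4 : 2 ^ (2 * j + 1) = 2 * 4 ^ j := by rw [pow_succ, pow_mul]; norm_num [mul_comm]
    have h4 := four_pow_mod j
    have hdvd : 3 ∣ p := by omega
    have := (Nat.prime_dvd_prime_iff_eq Nat.prime_three hp).1 hdvd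
    omega
end

section
/- Let G be a finite group and H a subgroup of G. If |H| is odd or the index [G : H] is odd, then H admits an inverse-closed right transversal in G (i.e., H is a subgroup perfect code of G). -/
open MulAction

/-- Let `π : X → Y` have finite fibers and let `ι` be an involution of `Y` preserving the sizes of
fibers. If every `ι`-stable fiber of odd size meets `F`, then `ι` lifts to an involution of `X`
all of whose fixed points lie in `F`. -/
theorem exists_involutive_lift {X Y : Type*} [Finite X] (π : X → Y) (ι : Y → Y)
    (hι : Function.Involutive ι)
    (hcard : ∀ x, (π ⁻¹' {ι (π x)}).ncard = (π ⁻¹' {π x}).ncard) (F : Set X)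
    (hF : ∀ x, ι (π x) = π x → Odd (π ⁻¹' {π x}).ncard → ∃ p ∈ F, π p = π x) :
    ∃ σ : X → X, Function.Involutive σ ∧ (∀ x, π (σ x) = ι (π x)) ∧ ∀ x, σ x = x → x ∈ F := by
  classical
  have key : ∀ y, ∃ e : π ⁻¹' {y} ≃ Fin (π ⁻¹' {y}).ncard,
      ∀ x, ι y = y → 2 * (e x : ℕ) + 1 = (π ⁻¹' {y}).ncard → (x : X) ∈ F := by
    intro y
    let e : π ⁻¹' {y} ≃ Fin (π ⁻¹' {y}).ncard := Finite.equivFinOfCardEq rfl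
    by_cases h : ∃ x : π ⁻¹' {y}, ι y = y ∧ 2 * (e x : ℕ) + 1 = (π ⁻¹' {y}).ncard
    · obtain ⟨x, hy, hx⟩ := h
      have hxy : π x = y := x.2
      obtain ⟨p, hpF, hp⟩ := hF x (by rw [hxy, hy]) (by rw [hxy]; exact ⟨e x, hx.symm⟩)
      let q : π ⁻¹' {y} := ⟨p, hp.trans hxy⟩
      refine ⟨(Equiv.swap q x).trans e, fun z _ hz => ?_⟩
      have h1 : e (Equiv.swap q x z) = e x := by
        apply Fin.ext
        simp only [Equiv.trans_apply] at hz
        omega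
      have h2 : z = q := by
        rw [← Equiv.swap_apply_right q x]
        exact (Equiv.swap_apply_eq_iff).1 (e.injective h1)
      rw [h2]
      exact hpF
    · exact ⟨e, fun x hy hx => (h ⟨x, hy, hx⟩).elim⟩
  choose e he using key
  have ex : ∀ x, ∃ x', ∃ h : π x' = ι (π x),
      (e _ ⟨x', h⟩ : ℕ) + e _ ⟨x, rfl⟩ + 1 = (π ⁻¹' {π x}).ncard := by
    intro x
    have hlt := (e _ ⟨x, rfl⟩ : Fin (π ⁻¹' {π x}).ncard).2
    let i : Fin (π ⁻¹' {ι (π x)}).ncard :=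
      ⟨(π ⁻¹' {π x}).ncard - 1 - e _ ⟨x, rfl⟩, by rw [hcard]; omega⟩
    refine ⟨(e _).symm i, ((e _).symm i).2, ?_⟩
    simp only [Subtype.coe_eta, Equiv.apply_symm_apply, i]
    omega
  have inj : ∀ y x x' (h : π x = y) (h' : π x' = y),
      (e y ⟨x, h⟩ : ℕ) = e y ⟨x', h'⟩ → x = x' := fun y x x' h h' hh =>
    congrArg Subtype.val ((e y).injective (Fin.ext hh))
  have cast : ∀ y y' x (h : π x = y) (h' : π x = y'), (e y ⟨x, h⟩ : ℕ) = e y' ⟨x, h'⟩ := by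
    rintro y y' x rfl rfl
    rfl
  choose σ hσ hσe using ex
  refine ⟨σ, fun x => ?_, hσ, fun x hx => ?_⟩
  · have h1 : π (σ (σ x)) = π x := by rw [hσ, hσ, hι]
    refine inj (π x) _ _ h1 rfl ?_
    have h2 := hσe x
    have h3 := hσe (σ x)
    have h4 := congrArg (fun y => (π ⁻¹' {y}).ncard) (hσ x)
    have h5 := hcard x
    rw [cast _ _ _ _ h1, cast _ _ _ rfl (hσ x)] at h3
    omega
  · have h1 : ι (π x) = π x := by rw [← hσ, hx]
    refine he (π x) ⟨x, rfl⟩ h1 ?_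
    have h2 := hσe x
    rw [cast _ (π x) _ _ (by rw [hx])] at h2
    simp only [hx] at h2
    omega

/-- In a transitive `G`-set `X` with base point `o`, an invariant relation on `X` has
`|X|` times as many elements as its fiber over `o`. -/
theorem ncard_eq_card_mul_ncard_fiber {G X : Type*} [Group G] [MulAction G X]
    [IsPretransitive G X] (o : X) (R : Set (X × X)) (hR : ∀ (g : G), ∀ p ∈ R, g • p ∈ R) :
    R.ncard = Nat.card X * {c | (o, c) ∈ R}.ncard := by
  choose s hs using fun a : X => exists_smul_eq G o a
  have hs' : ∀ a, (s a)⁻¹ • a = o := fun a => by rw [inv_smul_eq_iff, hs]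
  let f : R ≃ X × {c | (o, c) ∈ R} :=
    { toFun := fun p => (p.1.1, ⟨(s p.1.1)⁻¹ • p.1.2, by
        have h := hR (s p.1.1)⁻¹ p.1 p.2
        rwa [Prod.smul_def, hs'] at h⟩)
      invFun := fun q => ⟨(q.1, s q.1 • (q.2 : X)), by
        have h := hR (s q.1) _ q.2.2
        rwa [Prod.smul_mk, hs] at h⟩
      left_inv := fun p => by simp
      right_inv := fun q => by simp }
  rw [← Nat.card_coe_set_eq, Nat.card_congr f, Nat.card_prod, Nat.card_coe_set_eq]

theorem swap_preimage_orbit {G X : Type*} [Group G] [MulAction G X] (p : X × X) :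
    Prod.swap ⁻¹' orbit G p = orbit G p.swap := by
  ext q
  simp only [Set.mem_preimage, mem_orbit_iff, Prod.ext_iff, Prod.smul_fst, Prod.smul_snd,
    Prod.fst_swap, Prod.snd_swap, and_comm]

/-- A set of pairs that is closed under swapping and has odd size contains a diagonal element. -/
theorem exists_diag_mem_of_odd_ncard {X : Type*} [Finite X] (R : Set (X × X))
    (hR : Prod.swap ⁻¹' R = R) (hodd : Odd R.ncard) : ∃ c, (c, c) ∈ R := by
  have := Fintype.ofFinite R
  have hmem : ∀ p ∈ R, p.swap ∈ R := fun p => (Set.ext_iff.1 hR p).2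
  let τ : Equiv.Perm R := Function.Involutive.toPerm (fun p => ⟨p.1.swap, hmem p.1 p.2⟩)
    fun _ => rfl
  have hτ : τ ^ 2 ^ 1 = 1 := by
    ext p <;> rfl
  rw [← Nat.card_coe_set_eq, Nat.card_eq_fintype_card] at hodd
  obtain ⟨⟨⟨a, b⟩, hp⟩, hfix⟩ := Equiv.Perm.exists_fixed_point_of_prime
    (p := 2) hodd.not_two_dvd_nat hτ
  obtain rfl : b = a := congrArg (fun p : R => p.1.1) hfix
  exact ⟨b, hp⟩

/-- Suppose `H` has odd order or odd index. If the orbit of `(H, a)` on pairs of cosets is closed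
under swapping and has an odd fiber over `H`, then it contains `(H, uH)` for some `u` with
`u⁻¹ = u`. -/
theorem exists_inv_eq_self_of_orbit_swap {G : Type*} [Group G] [Finite G] (H : Subgroup G)
    (h : Odd (Nat.card H) ∨ Odd H.index) (a : G ⧸ H)
    (ha : Prod.swap ⁻¹' orbit G (((1 : G) : G ⧸ H), a) = orbit G (((1 : G) : G ⧸ H), a))
    (hodd : Odd {c | (((1 : G) : G ⧸ H), c) ∈ orbit G (((1 : G) : G ⧸ H), a)}.ncard) :
    ∃ u : G, u⁻¹ = u ∧
      orbit G (((1 : G) : G ⧸ H), (u : G ⧸ H)) = orbit G (((1 : G) : G ⧸ H), a) := by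
  rcases h with h | h
  · have h1 : (((1 : G) : G ⧸ H), a).swap ∈ orbit G (((1 : G) : G ⧸ H), a) := by
      rw [← ha]
      exact mem_orbit_self _
    obtain ⟨t, ht⟩ := h1
    have ht1 : (t : G ⧸ H) = a := by simpa using congrArg Prod.fst ht
    have ht2 : t • a = ((1 : G) : G ⧸ H) := by simpa using congrArg Prod.snd ht
    have htH : t * t ∈ H := by
      rw [← ht1, MulAction.Quotient.smul_coe, smul_eq_mul, eq_comm, QuotientGroup.eq] at ht2
      simpa using ht2
    have hr : Odd (orderOf (t * t)) :=
      h.of_dvd_nat (H.orderOf_dvd_natCard htH)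
    obtain ⟨k, hk⟩ := hr
    refine ⟨t * (t * t) ^ k, ?_, ?_⟩
    · rw [inv_eq_iff_mul_eq_one]
      have h2 := pow_orderOf_eq_one (t * t)
      rw [hk] at h2
      rw [← h2]
      simp only [← pow_two, ← pow_mul, ← pow_succ']
      ring_nf
    · congr 2
      rw [← ht1, eq_comm, QuotientGroup.eq]
      simpa using H.pow_mem htH k
  · have h1 : Odd (orbit G (((1 : G) : G ⧸ H), a)).ncard := by
      rw [ncard_eq_card_mul_ncard_fiber (G := G) ((1 : G) : G ⧸ H) _
        fun g p hp => mem_orbit_of_mem_orbit g hp]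
      exact h.mul hodd
    obtain ⟨c, g, hg⟩ := exists_diag_mem_of_odd_ncard _ ha h1
    have h2 : g • ((1 : G) : G ⧸ H) = c := congrArg Prod.fst hg
    have h3 : g • a = c := congrArg Prod.snd hg
    refine ⟨1, inv_one, ?_⟩
    rw [smul_left_cancel g (h2.trans h3.symm)]

theorem isComplement_inv_inv {G : Type*} [Group G] {S T : Set G} (h : Subgroup.IsComplement S T) :
    Subgroup.IsComplement T⁻¹ S⁻¹ := by
  let e : (T⁻¹ : Set G) × (S⁻¹ : Set G) ≃ S × T :=
    { toFun := fun x => (⟨(x.2 : G)⁻¹, x.2.2⟩, ⟨(x.1 : G)⁻¹, x.1.2⟩)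
      invFun := fun x => (⟨(x.2 : G)⁻¹, Set.inv_mem_inv.2 x.2.2⟩,
        ⟨(x.1 : G)⁻¹, Set.inv_mem_inv.2 x.1.2⟩)
      left_inv := fun x => by simp
      right_inv := fun x => by simp }
  have hb := (Equiv.inv G).bijective.comp (h.comp e.bijective)
  refine (congrArg Function.Bijective ?_).mp hb
  funext x
  simp [e]

theorem stmt_9 {G : Type*} [Group G] [Fintype G] (H : Subgroup G)
    (h : Odd (Nat.card H) ∨ Odd H.index) :
    ∃ T : Set G, Subgroup.IsComplement (H : Set G) T ∧ T⁻¹ = T := by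
  let o : G ⧸ H := (1 : G)
  let π : G ⧸ H → Set ((G ⧸ H) × (G ⧸ H)) := fun a => orbit G (o, a)
  have hfib : ∀ p, π ⁻¹' {orbit G p} = {c | (o, c) ∈ orbit G p} := fun p => by
    ext c
    exact orbit_eq_iff
  have hcard : ∀ a, (π ⁻¹' {Prod.swap ⁻¹' π a}).ncard = (π ⁻¹' {π a}).ncard := by
    intro a
    have hinv : ∀ p : (G ⧸ H) × (G ⧸ H), ∀ g : G, ∀ q ∈ orbit G p, g • q ∈ orbit G p :=
      fun p g q hq => mem_orbit_of_mem_orbit g hq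
    have h1 : (Prod.swap ⁻¹' π a).ncard = (π a).ncard :=
      Set.ncard_preimage_of_injective_subset_range Prod.swap_injective
        (by rw [Prod.swap_surjective.range_eq]; exact Set.subset_univ _)
    simp only [π, swap_preimage_orbit] at h1 ⊢
    rw [ncard_eq_card_mul_ncard_fiber o _ (hinv _), ncard_eq_card_mul_ncard_fiber o _ (hinv _)]
      at h1
    rw [hfib, hfib]
    exact Nat.eq_of_mul_eq_mul_left Nat.card_pos h1
  obtain ⟨σ, hσ, hσπ, hσF⟩ := exists_involutive_lift π (Prod.swap ⁻¹' ·) (fun _ => rfl) hcard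
    {a | ∃ u : G, u⁻¹ = u ∧ (u : G ⧸ H) = a} (fun a ha hodd => by
      rw [hfib] at hodd
      obtain ⟨u, hu, hua⟩ := exists_inv_eq_self_of_orbit_swap H h a ha hodd
      exact ⟨u, ⟨u, hu, rfl⟩, hua⟩)
  have ht : ∀ a, ∃ t : G, (t : G ⧸ H) = a ∧ ((t⁻¹ : G) : G ⧸ H) = σ a ∧ (σ a = a → t⁻¹ = t) := by
    intro a
    by_cases hfix : σ a = a
    · obtain ⟨u, hu, hua⟩ := hσF a hfix
      exact ⟨u, hua, by rw [hu, hua, hfix], fun _ => hu⟩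
    · have h1 : (o, σ a) ∈ Prod.swap ⁻¹' π a := by
        rw [← hσπ]
        exact mem_orbit_self _
      obtain ⟨g, hg⟩ := h1
      have h2 : (g : G ⧸ H) = σ a := by simpa [o] using congrArg Prod.fst hg
      have h3 : g • a = o := congrArg Prod.snd hg
      refine ⟨g⁻¹, ?_, by rw [inv_inv, h2], fun h => (hfix h).elim⟩
      rw [eq_comm, ← inv_smul_eq_iff.2 h3.symm]
      simp [o]
  choose t ht1 ht2 ht3 using ht
  obtain ⟨n, ⟨e⟩⟩ := Finite.exists_equiv_fin (G ⧸ H)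
  let f : G ⧸ H → G := fun a => if e a ≤ e (σ a) then t a else (t (σ a))⁻¹
  have hf : ∀ a, (f a : G ⧸ H) = a := by
    intro a
    simp only [f]
    split_ifs
    · exact ht1 a
    · rw [ht2, hσ]
  have hfσ : ∀ a, (f a)⁻¹ = f (σ a) := by
    intro a
    simp only [f, hσ a]
    rcases lt_trichotomy (e a) (e (σ a)) with hlt | heq | hlt
    · rw [if_pos hlt.le, if_neg hlt.not_ge]
    · have hfix := (e.injective heq).symm
      simp only [hfix, le_refl, if_true, ht3 a hfix]
    · rw [if_neg hlt.not_ge, if_pos hlt.le, inv_inv]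
  have hinv : (Set.range f)⁻¹ = Set.range f := by
    ext x
    simp only [Set.mem_inv, Set.mem_range]
    constructor
    · rintro ⟨a, ha⟩
      exact ⟨σ a, by rw [← hfσ, ha, inv_inv]⟩
    · rintro ⟨a, ha⟩
      exact ⟨σ a, by rw [← hfσ, ha]⟩
  refine ⟨Set.range f, ?_, hinv⟩
  simpa only [hinv, inv_coe_set] using isComplement_inv_inv (Subgroup.isComplement_range_left hf)
end

section
/- Let G be a finite group whose Sylow 2-subgroups are cyclic or generalized quaternion (equivalently, G has a unique involution in each Sylow 2-subgroup). Then a subgroup H ≤ G is a subgroup perfect code of G if and only if |H| is odd or [G : H] is odd. -/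
open MulAction

section InverseClosedTransversal

variable {G : Type*} [Group G] {H : Subgroup G}

theorem isComplement_iff_existsUnique_mk_of_inv_eq {T : Set G} (hT : T⁻¹ = T) :
    Subgroup.IsComplement (H : Set G) T ↔ ∀ q : G ⧸ H, ∃! t, t ∈ T ∧ (t : G ⧸ H) = q := by
  have hinv : ∀ t, t ∈ T → t⁻¹ ∈ T := fun t ht => by
    rw [← hT]; simpa using ht
  rw [Subgroup.isComplement_iff_existsUnique_mul_inv_mem]
  constructor
  · intro h q
    induction q using QuotientGroup.induction_on with
    | H g =>
      obtain ⟨t, ht, hu⟩ := h g⁻¹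
      refine ⟨(t : G)⁻¹, ⟨hinv _ t.2, ?_⟩, ?_⟩
      · exact (QuotientGroup.eq.2 ht).symm
      · rintro s ⟨hs, hsg⟩
        have := hu ⟨s⁻¹, hinv s hs⟩ (by simpa using QuotientGroup.eq.1 hsg.symm)
        rw [← this, inv_inv]
  · intro h g
    obtain ⟨t, ⟨ht, htg⟩, hu⟩ := h ((g⁻¹ : G) : G ⧸ H)
    refine ⟨⟨t⁻¹, hinv t ht⟩, ?_, ?_⟩
    · simpa using QuotientGroup.eq.1 htg.symm
    · rintro ⟨s, hs⟩ hsg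
      have := hu s⁻¹ ⟨hinv s hs, (QuotientGroup.eq.2 (by simpa using hsg)).symm⟩
      rw [Subtype.mk.injEq, ← this, inv_inv]

theorem mk_mem_orbit_iff {x y : G} :
    (y : G ⧸ H) ∈ orbit H (x : G ⧸ H) ↔ ∃ h ∈ H, ∃ k ∈ H, y = h * x * k := by
  constructor
  · rintro ⟨h, hh⟩
    have : ((h * x : G) : G ⧸ H) = y := hh
    exact ⟨h, h.2, _, QuotientGroup.eq.1 this, by group⟩
  · rintro ⟨h, hh, k, hk, rfl⟩
    refine ⟨⟨h, hh⟩, ?_⟩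
    change ((h * x : G) : G ⧸ H) = _
    exact QuotientGroup.eq.2 (by group; exact hk)

theorem mk_inv_mem_orbit_inv {x y : G} (h : (y : G ⧸ H) ∈ orbit H (x : G ⧸ H)) :
    ((y⁻¹ : G) : G ⧸ H) ∈ orbit H ((x⁻¹ : G) : G ⧸ H) := by
  obtain ⟨l, hl, k, hk, rfl⟩ := mk_mem_orbit_iff.1 h
  exact mk_mem_orbit_iff.2 ⟨k⁻¹, H.inv_mem hk, l⁻¹, H.inv_mem hl, by group⟩

theorem exists_mk_eq_mk_inv_eq {x : G} {c d : G ⧸ H} (hc : c ∈ orbit H (x : G ⧸ H))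
    (hd : d ∈ orbit H ((x⁻¹ : G) : G ⧸ H)) :
    ∃ g : G, (g : G ⧸ H) = c ∧ ((g⁻¹ : G) : G ⧸ H) = d := by
  obtain ⟨h, rfl⟩ := hc
  obtain ⟨k, rfl⟩ := hd
  refine ⟨h * x * (k : G)⁻¹, ?_, ?_⟩
  · change _ = ((h * x : G) : G ⧸ H)
    exact QuotientGroup.eq.2 (by group; exact k.2)
  · change _ = ((k * x⁻¹ : G) : G ⧸ H)
    exact QuotientGroup.eq.2 (by group; exact h.2)

theorem mem_stabilizer_mk_iff {x : G} {h : H} :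
    h ∈ stabilizer H (x : G ⧸ H) ↔ x⁻¹ * h * x ∈ H := by
  rw [mem_stabilizer_iff]
  change ((h * x : G) : G ⧸ H) = x ↔ _
  rw [eq_comm, QuotientGroup.eq, mul_assoc]

theorem ncard_orbit_inv [Finite G] (x : G) :
    (orbit H ((x⁻¹ : G) : G ⧸ H)).ncard = (orbit H (x : G ⧸ H)).ncard := by
  have e : stabilizer H ((x⁻¹ : G) : G ⧸ H) ≃ stabilizer H (x : G ⧸ H) :=
    { toFun h := ⟨⟨x * h * x⁻¹, by simpa using mem_stabilizer_mk_iff.1 h.2⟩,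
        mem_stabilizer_mk_iff.2 (by simp [mul_assoc])⟩
      invFun h := ⟨⟨x⁻¹ * h * x, mem_stabilizer_mk_iff.1 h.2⟩,
        mem_stabilizer_mk_iff.2 (by simp [mul_assoc])⟩
      left_inv h := by ext; simp [mul_assoc]
      right_inv h := by ext; simp [mul_assoc] }
  have h₁ := (stabilizer H ((x⁻¹ : G) : G ⧸ H)).card_mul_index
  rw [← (stabilizer H (x : G ⧸ H)).card_mul_index, Nat.card_congr e] at h₁
  simpa [index_stabilizer] using Nat.eq_of_mul_eq_mul_left Nat.card_pos h₁

/-- `T` is inverse-closed and consists of exactly one element of every coset in `C`. -/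
def IsInverseClosedTransversalOn (C : Set (G ⧸ H)) (T : Set G) : Prop :=
  T⁻¹ = T ∧ (∀ t ∈ T, (t : G ⧸ H) ∈ C) ∧ ∀ q ∈ C, ∃! t, t ∈ T ∧ (t : G ⧸ H) = q

theorem exists_isInverseClosedTransversalOn_union {C D : Set (G ⧸ H)} (hCD : Disjoint C D)
    (e : C ≃ D) (h : ∀ c ∈ C, ∀ d ∈ D, ∃ g : G, (g : G ⧸ H) = c ∧ ((g⁻¹ : G) : G ⧸ H) = d) :
    ∃ T, IsInverseClosedTransversalOn (C ∪ D) T := by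
  choose f hf hf' using fun c : C => h c c.2 (e c) (e c).2
  rw [Set.disjoint_left] at hCD
  refine ⟨{t | ∃ c, t = f c ∨ t = (f c)⁻¹}, ?_, ?_, ?_⟩
  · ext t
    simp only [Set.mem_inv, Set.mem_ofPred_eq, inv_eq_iff_eq_inv, inv_inv]
    exact exists_congr fun c => or_comm
  · rintro t ⟨c, rfl | rfl⟩
    · exact Or.inl ((hf c).symm ▸ c.2)
    · exact Or.inr ((hf' c).symm ▸ (e c).2)
  · rintro q (hq | hq)
    · refine ⟨f ⟨q, hq⟩, ⟨⟨_, Or.inl rfl⟩, hf _⟩, ?_⟩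
      rintro t ⟨⟨c, rfl | rfl⟩, ht⟩
      · rw [hf] at ht
        subst ht
        rfl
      · rw [hf'] at ht
        exact (hCD hq (ht ▸ (e c).2)).elim
    · refine ⟨(f (e.symm ⟨q, hq⟩))⁻¹, ⟨⟨_, Or.inr rfl⟩, by rw [hf']; simp⟩, ?_⟩
      rintro t ⟨⟨c, rfl | rfl⟩, ht⟩
      · rw [hf] at ht
        exact (hCD (ht ▸ c.2) hq).elim
      · rw [hf'] at ht
        subst ht
        simp

theorem exists_isInverseClosedTransversalOn_of_even [Finite G] {C : Set (G ⧸ H)}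
    (hC : Even C.ncard)
    (h : ∀ c ∈ C, ∀ d ∈ C, ∃ g : G, (g : G ⧸ H) = c ∧ ((g⁻¹ : G) : G ⧸ H) = d) :
    ∃ T, IsInverseClosedTransversalOn C T := by
  obtain ⟨m, hm⟩ := hC
  obtain ⟨A, hAC, hA⟩ := Set.exists_subset_card_eq (s := C) (n := m) (by omega)
  have hB : (C \ A).ncard = m := by rw [Set.ncard_sdiff hAC]; omega
  obtain ⟨e⟩ : Nonempty (A ≃ (C \ A : Set (G ⧸ H))) :=
    Finite.card_eq.1 (by rw [Nat.card_coe_set_eq, Nat.card_coe_set_eq, hA, hB])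
  have := exists_isInverseClosedTransversalOn_union Set.disjoint_sdiff_right e
    fun c hc d hd => h c (hAC hc) d hd.1
  rwa [Set.union_sdiff_cancel hAC] at this

theorem exists_isInverseClosedTransversalOn_of_odd [Finite G] {C : Set (G ⧸ H)}
    (hC : Odd C.ncard) {y : G} (hy : (y : G ⧸ H) ∈ C) (hy' : y * y = 1)
    (h : ∀ c ∈ C, ∀ d ∈ C, ∃ g : G, (g : G ⧸ H) = c ∧ ((g⁻¹ : G) : G ⧸ H) = d) :
    ∃ T, IsInverseClosedTransversalOn C T := by
  have hcard := Set.ncard_sdiff_singleton_add_one hy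
  obtain ⟨T, hT, hTC, hTu⟩ := exists_isInverseClosedTransversalOn_of_even
    (C := C \ {(y : G ⧸ H)}) (by rw [← hcard] at hC; grind)
    fun c hc d hd => h c hc.1 d hd.1
  refine ⟨insert y T, ?_, ?_, ?_⟩
  · rw [Set.inv_insert, hT, inv_eq_of_mul_eq_one_left hy']
  · rintro t (rfl | ht)
    · exact hy
    · exact (hTC t ht).1
  · intro q hq
    by_cases hqy : q = y
    · subst hqy
      refine ⟨y, ⟨Set.mem_insert _ _, rfl⟩, ?_⟩
      rintro t ⟨rfl | ht, hty⟩
      · rfl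
      · exact ((hTC t ht).2 hty).elim
    · obtain ⟨t, ⟨ht, htq⟩, hu⟩ := hTu q ⟨hq, hqy⟩
      refine ⟨t, ⟨Set.mem_insert_of_mem _ ht, htq⟩, ?_⟩
      rintro s ⟨rfl | hs, hsq⟩
      · exact (hqy hsq.symm).elim
      · exact hu s ⟨hs, hsq⟩

theorem exists_isInverseClosedTransversalOn_orbit [Finite G]
    (hH : ∀ x : G, x * x ∈ H → Odd (orbit H (x : G ⧸ H)).ncard →
      ∃ y : G, (y : G ⧸ H) = x ∧ y * y = 1) (x : G) :
    ∃ T, IsInverseClosedTransversalOn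
      (orbit H (x : G ⧸ H) ∪ orbit H ((x⁻¹ : G) : G ⧸ H)) T := by
  by_cases hx : ((x⁻¹ : G) : G ⧸ H) ∈ orbit H (x : G ⧸ H)
  · have horb := orbit_eq_iff.2 hx
    have hadj : ∀ c ∈ orbit H (x : G ⧸ H), ∀ d ∈ orbit H (x : G ⧸ H),
        ∃ g : G, (g : G ⧸ H) = c ∧ ((g⁻¹ : G) : G ⧸ H) = d :=
      fun c hc d hd => exists_mk_eq_mk_inv_eq hc (horb.symm ▸ hd)
    rw [horb, Set.union_self]
    rcases Nat.even_or_odd (orbit H (x : G ⧸ H)).ncard with heven | hodd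
    · exact exists_isInverseClosedTransversalOn_of_even heven hadj
    · obtain ⟨h, hh, k, hk, hxk⟩ := mk_mem_orbit_iff.1 hx
      have hxh : ((x * h : G) : G ⧸ H) = x :=
        (QuotientGroup.eq.2 (by simpa using hh)).symm
      have hsq : x * h * (x * h) ∈ H := by
        have : k⁻¹ = x * h * x := inv_eq_of_mul_eq_one_left (by
          rw [mul_assoc x, mul_assoc x, ← hxk, mul_inv_cancel])
        rw [← mul_assoc, ← this]
        exact H.mul_mem (H.inv_mem hk) hh
      obtain ⟨y, hy, hy'⟩ := hH (x * h) hsq (by rwa [hxh])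
      exact exists_isInverseClosedTransversalOn_of_odd hodd
        (by rw [hy, hxh]; exact mem_orbit_self _) hy' hadj
  · refine exists_isInverseClosedTransversalOn_union ?_ (Nonempty.some ?_)
      fun c hc d hd => exists_mk_eq_mk_inv_eq hc hd
    · rw [Set.disjoint_left]
      intro c hc hc'
      rw [← orbit_eq_iff] at hc hc'
      exact hx (hc ▸ hc' ▸ mem_orbit_self _)
    · rw [← Finite.card_eq, Nat.card_coe_set_eq, Nat.card_coe_set_eq, ncard_orbit_inv]

theorem exists_isComplement_inv_eq [Finite G]
    (hH : ∀ x : G, x * x ∈ H → Odd (orbit H (x : G ⧸ H)).ncard →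
      ∃ y : G, (y : G ⧸ H) = x ∧ y * y = 1) :
    ∃ T : Set G, Subgroup.IsComplement (H : Set G) T ∧ T⁻¹ = T := by
  let E : G → Set (G ⧸ H) := fun x => orbit H (x : G ⧸ H) ∪ orbit H ((x⁻¹ : G) : G ⧸ H)
  have hE : ∀ x y : G, (y : G ⧸ H) ∈ E x → E y = E x := by
    rintro x y (h | h)
    · have h' := mk_inv_mem_orbit_inv h
      rw [← orbit_eq_iff] at h h'
      simp only [E, h, h']
    · have h' := mk_inv_mem_orbit_inv h
      rw [← orbit_eq_iff] at h h'
      rw [inv_inv] at h'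
      simp only [E, h, h', Set.union_comm]
  have hEinv : ∀ x, E x⁻¹ = E x := fun x => by simp only [E, inv_inv, Set.union_comm]
  have hself : ∀ x : G, (x : G ⧸ H) ∈ E x := fun x => Or.inl (mem_orbit_self _)
  have key : ∀ C : Set (G ⧸ H), ∃ T : Set G, ∀ x, E x = C → IsInverseClosedTransversalOn C T := by
    intro C
    by_cases hC : ∃ x, E x = C
    · obtain ⟨x, rfl⟩ := hC
      obtain ⟨T, hT⟩ := exists_isInverseClosedTransversalOn_orbit hH x
      exact ⟨T, fun _ _ => hT⟩
    · exact ⟨∅, fun x hx => (hC ⟨x, hx⟩).elim⟩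
  choose τ hτ using key
  have hT : {t | t ∈ τ (E t)}⁻¹ = {t | t ∈ τ (E t)} := by
    ext t
    rw [Set.mem_inv, Set.mem_ofPred_eq, Set.mem_ofPred_eq, hEinv, ← Set.mem_inv, (hτ _ t rfl).1]
  refine ⟨_, (isComplement_iff_existsUnique_mk_of_inv_eq hT).2 fun q => ?_, hT⟩
  induction q using QuotientGroup.induction_on with
  | H g =>
    have hEg : ∀ t : G, (t : G ⧸ H) = g → E t = E g := fun t ht => hE _ _ (ht ▸ hself g)
    obtain ⟨t, ⟨ht, htg⟩, hu⟩ := (hτ _ g rfl).2.2 g (hself g)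
    refine ⟨t, ⟨?_, htg⟩, ?_⟩
    · rwa [Set.mem_ofPred_eq, hEg t htg]
    · rintro s ⟨hs, hsg⟩
      rw [Set.mem_ofPred_eq, hEg s hsg] at hs
      exact hu s ⟨hs, hsg⟩

theorem exists_mk_eq_mul_self_eq_one_of_odd_card [Finite G] (hH : Odd (Nat.card H)) {x : G}
    (hx : x * x ∈ H) : ∃ y : G, (y : G ⧸ H) = x ∧ y * y = 1 := by
  obtain ⟨m, hm⟩ := hH
  have h1 : (x * x) ^ Nat.card H = 1 :=
    congrArg Subtype.val (pow_card_eq_one' (x := (⟨x * x, hx⟩ : H)))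
  refine ⟨x ^ Nat.card H, (QuotientGroup.eq.2 ?_).symm, ?_⟩
  · rw [hm, pow_succ', pow_mul, inv_mul_cancel_left, pow_two]
    exact H.pow_mem hx m
  · rw [← (Commute.refl x).mul_pow, h1]

theorem mem_of_odd_index_of_odd_orbit [Finite G] (hH : Odd H.index) {x : G} (hx : x * x ∈ H)
    (hodd : Odd (orbit H (x : G ⧸ H)).ncard) : x ∈ H := by
  have : Fact (Nat.Prime 2) := ⟨Nat.prime_two⟩
  let K : Subgroup G := (stabilizer H (x : G ⧸ H)).map H.subtype
  have hK : ∀ g, g ∈ K ↔ g ∈ H ∧ x⁻¹ * g * x ∈ H := by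
    intro g
    simp only [K, Subgroup.mem_map, mem_stabilizer_mk_iff, Subgroup.subtype_apply]
    constructor
    · rintro ⟨h, hh, rfl⟩
      exact ⟨h.2, hh⟩
    · rintro ⟨hg, hg'⟩
      exact ⟨⟨g, hg⟩, hg', rfl⟩
  have hKodd : Odd K.index := by
    rw [Subgroup.index_map_subtype, index_stabilizer]
    exact hodd.mul hH
  have hxxK : x * x ∈ K := (hK _).2 ⟨hx, by simpa [mul_assoc] using hx⟩
  have hconj : ∀ g, g ∈ K → x⁻¹ * g * x ∈ K := by
    intro g hg
    rw [hK] at hg ⊢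
    refine ⟨hg.2, ?_⟩
    have := H.mul_mem (H.mul_mem (H.inv_mem hx) hg.1) hx
    simpa [mul_assoc] using this
  let f : G ⧸ K → G ⧸ K := Quotient.map' (fun g => g * x) fun a b hab => by
    rw [QuotientGroup.leftRel_apply] at hab ⊢
    simpa [mul_assoc] using hconj _ hab
  have hf : Function.Involutive f := by
    intro q
    induction q using QuotientGroup.induction_on with
    | H g =>
      change ((g * x * x : G) : G ⧸ K) = g
      exact (QuotientGroup.eq.2 (by simpa [mul_assoc] using hxxK)).symm
  have := Fintype.ofFinite (G ⧸ K)
  obtain ⟨q, hq⟩ := Equiv.Perm.exists_fixed_point_of_prime (p := 2) (n := 1)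
    (σ := hf.toPerm) (by
      rw [← Nat.card_eq_fintype_card]
      exact hKodd.not_two_dvd_nat) (by
      ext q
      simp [pow_two, hf q])
  induction q using QuotientGroup.induction_on with
  | H g =>
    have : ((g * x : G) : G ⧸ K) = g := hq
    have := QuotientGroup.eq.1 this.symm
    exact ((hK _).1 (by simpa using this)).1

theorem exists_sq_mem_odd_orbit [Finite G] (hH : Even H.index) :
    ∃ x : G, x ∉ H ∧ x * x ∈ H ∧ Odd (orbit H (x : G ⧸ H)).ncard := by
  have : Fact (Nat.Prime 2) := ⟨Nat.prime_two⟩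
  obtain ⟨Q⟩ : Nonempty (Sylow 2 H) := inferInstance
  have hQ := Q.card_eq_multiplicity
  set n := (Nat.card H).factorization 2
  let Q' : Subgroup G := (Q : Subgroup H).map H.subtype
  have hQ' : Nat.card Q' = 2 ^ n := by
    rw [← hQ]
    exact Subgroup.card_map_of_injective H.subtype_injective
  have hdvd : 2 ^ (n + 1) ∣ Nat.card G := by
    rw [← H.card_mul_index, pow_succ]
    exact mul_dvd_mul (Nat.ordProj_dvd _ _) hH.two_dvd
  obtain ⟨R, hR, hQR⟩ := Sylow.exists_subgroup_card_pow_succ hdvd hQ'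
  have hRH : ¬ R ≤ H := by
    intro h
    have := Subgroup.card_dvd_of_le h
    rw [hR] at this
    exact Nat.pow_succ_factorization_not_dvd Nat.card_pos.ne' Nat.prime_two this
  obtain ⟨x, hxR, hxH⟩ := SetLike.not_le_iff_exists.1 hRH
  have hidx : (Q'.subgroupOf R).index = 2 := by
    have := (Q'.subgroupOf R).card_mul_index
    rw [Nat.card_congr (Subgroup.subgroupOfEquivOfLe hQR).toEquiv, hQ', hR, pow_succ] at this
    exact Nat.eq_of_mul_eq_mul_left (by positivity) this
  have hQH : Q' ≤ H := Subgroup.map_subtype_le _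
  have hnorm := Subgroup.normal_of_index_eq_two hidx
  refine ⟨x, hxH, hQH (Subgroup.mul_self_mem_of_index_two hidx ⟨x, hxR⟩), ?_⟩
  rw [← index_stabilizer]
  have hle : (Q : Subgroup H) ≤ stabilizer H (x : G ⧸ H) := by
    intro q hq
    rw [mem_stabilizer_mk_iff]
    have hqQ : (q : G) ∈ Q' := ⟨q, hq, rfl⟩
    have := hnorm.conj_mem ⟨q, hQR hqQ⟩ hqQ ⟨x⁻¹, R.inv_mem hxR⟩
    rw [Subgroup.mem_subgroupOf] at this
    simpa using hQH this
  have hQi : ¬ 2 ∣ (Q : Subgroup H).index := Q.not_dvd_index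
  rw [← Nat.not_even_iff_odd, even_iff_two_dvd]
  exact fun h => hQi (h.trans (Subgroup.index_dvd_of_le hle))

end InverseClosedTransversal

theorem Function.Involutive.card_modEq_card_fixedPoints {α : Type*} [Finite α] {f : α → α}
    (hf : Function.Involutive f) :
    Nat.card α ≡ Nat.card (Function.fixedPoints f) [MOD 2] := by
  classical
  have : Fact (Nat.Prime 2) := ⟨Nat.prime_two⟩
  have := Fintype.ofFinite α
  have h := Equiv.Perm.card_fixedPoints_modEq (p := 2) (n := 1) (f := (f : Function.End α))
    (funext hf)
  rwa [← Nat.card_eq_fintype_card, ← Nat.card_eq_fintype_card] at h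

theorem exists_commute_involution {G : Type*} [Group G] [Finite G] {K : Subgroup G} {y : G}
    (hK : Even (Nat.card K)) (hy : y * y = 1) (hconj : ∀ k ∈ K, y * k * y ∈ K) :
    ∃ t ∈ K, t ≠ 1 ∧ t * t = 1 ∧ Commute y t := by
  have : Fact (Nat.Prime 2) := ⟨Nat.prime_two⟩
  let f : K → K := fun k => ⟨y * k * y, hconj k k.2⟩
  have hf : Function.Involutive f := fun k => by
    ext
    simp only [f]
    rw [show y * (y * k * y) * y = (y * y) * k * (y * y) by group, hy, one_mul, mul_one]
  have hfix : ∀ k : K, f k = k ↔ Commute y k := by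
    intro k
    rw [Subtype.ext_iff]
    change y * k * y = k ↔ y * k = k * y
    rw [← mul_left_inj y, mul_assoc _ y y, hy, mul_one]
  let C : Subgroup K := (Subgroup.centralizer {y}).subgroupOf K
  have hC : Nat.card (Function.fixedPoints f) = Nat.card C := by
    refine Nat.card_congr (Equiv.subtypeEquivRight fun k => ?_)
    change f k = k ↔ _
    rw [hfix, Subgroup.mem_subgroupOf, Subgroup.mem_centralizer_singleton_iff]
    exact ⟨fun h => h.eq.symm, fun h => h.symm⟩
  have h2 : 2 ∣ Nat.card C := by
    have := hf.card_modEq_card_fixedPoints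
    rw [hC] at this
    exact (this.dvd_iff dvd_rfl).1 hK.two_dvd
  obtain ⟨t, ht⟩ := exists_prime_orderOf_dvd_card' 2 h2
  obtain ⟨ht2, ht1⟩ := orderOf_eq_prime_iff.1 ht
  refine ⟨(t : K), (t : K).2, ?_, ?_, ?_⟩
  · simpa using ht1
  · simpa [pow_two] using congrArg (fun z : C => ((z : K) : G)) ht2
  · have := t.2
    rw [Subgroup.mem_subgroupOf, Subgroup.mem_centralizer_singleton_iff] at this
    exact this.symm

theorem IsCyclic.involution_unique {P : Type*} [Group P] [Finite P] [IsCyclic P] {a b : P}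
    (ha : a * a = 1) (ha' : a ≠ 1) (hb : b * b = 1) (hb' : b ≠ 1) : a = b := by
  classical
  by_contra hab
  have := Fintype.ofFinite P
  have h := IsCyclic.card_pow_eq_one_le (α := P) (n := 2) two_pos
  have hsub : ({1, a, b} : Finset P) ⊆ Finset.univ.filter fun x => x ^ 2 = 1 := by
    intro x hx
    simp only [Finset.mem_insert, Finset.mem_singleton] at hx
    rcases hx with rfl | rfl | rfl <;> simp [pow_two, *]
  have := (Finset.card_le_card hsub).trans h
  rw [Finset.card_eq_three.2 ⟨1, a, b, ha'.symm, hb'.symm, hab, rfl⟩] at this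
  omega

theorem QuaternionGroup.eq_a_of_involution {n : ℕ} [NeZero n] {g : QuaternionGroup n}
    (hg : g * g = 1) (hg' : g ≠ 1) : g = a n := by
  have hn := NeZero.pos n
  have : NeZero (2 * n) := ⟨by omega⟩
  cases g with
  | a i =>
    rw [a_mul_a, one_def, a.injEq] at hg
    rw [one_def, Ne, a.injEq] at hg'
    rw [a.injEq]
    have h1 := ZMod.val_lt i
    have h2 : i.val ≠ 0 := fun h => hg' ((ZMod.val_eq_zero i).1 h)
    have h3 : 2 * n ∣ i.val + i.val := by
      rw [← ZMod.natCast_eq_zero_iff]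
      simpa using hg
    obtain ⟨c, hc⟩ := h3
    have hc1 : c = 1 := by
      rcases c with _ | _ | c
      · omega
      · rfl
      · nlinarith
    rw [← ZMod.natCast_zmod_val i]
    congr 1
    subst hc1
    omega
  | xa i =>
    have := orderOf_dvd_of_pow_eq_one ((pow_two (xa i)).trans hg)
    rw [orderOf_xa] at this
    omega

theorem commuting_involutions_eq {G : Type*} [Group G] [Finite G]
    (hSyl : ∀ P : Sylow 2 G, IsCyclic P ∨
      ∃ n : ℕ, 1 ≤ n ∧ Nonempty (P ≃* QuaternionGroup (2 ^ n)))
    {a b : G} (ha : a * a = 1) (ha' : a ≠ 1) (hb : b * b = 1) (hb' : b ≠ 1)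
    (hab : Commute a b) : a = b := by
  have : Fact (Nat.Prime 2) := ⟨Nat.prime_two⟩
  have hp : ∀ c : G, c * c = 1 → c ≠ 1 → IsPGroup 2 (Subgroup.zpowers c) := fun c hc hc' =>
    IsPGroup.of_card (n := 1) (by
      rw [Nat.card_zpowers, pow_one, orderOf_eq_prime (by rwa [pow_two]) hc'])
  have hsup : IsPGroup 2 (Subgroup.zpowers a ⊔ Subgroup.zpowers b : Subgroup G) := by
    refine (hp a ha ha').to_sup_of_normal_right' (hp b hb hb') ?_
    refine le_trans ?_ (Subgroup.centralizer_le_normalizer _)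
    rw [Subgroup.zpowers_le, Subgroup.mem_centralizer_iff]
    rintro _ ⟨k, rfl⟩
    exact (hab.zpow_right k).eq.symm
  obtain ⟨P, hP⟩ := hsup.exists_le_sylow
  have haP : a ∈ P := hP (Subgroup.mem_sup_left (Subgroup.mem_zpowers a))
  have hbP : b ∈ P := hP (Subgroup.mem_sup_right (Subgroup.mem_zpowers b))
  suffices h : (⟨a, haP⟩ : P) = ⟨b, hbP⟩ from congrArg Subtype.val h
  have hs : ∀ c : G, c * c = 1 → ∀ hc : c ∈ P, (⟨c, hc⟩ : P) * ⟨c, hc⟩ = 1 :=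
    fun c h hc => Subtype.ext h
  have hne : ∀ c : G, c ≠ 1 → ∀ hc : c ∈ P, (⟨c, hc⟩ : P) ≠ 1 :=
    fun c h hc he => h (congrArg Subtype.val he)
  rcases hSyl P with hcyc | ⟨n, -, ⟨e⟩⟩
  · exact IsCyclic.involution_unique (hs a ha haP) (hne a ha' haP) (hs b hb hbP) (hne b hb' hbP)
  · apply e.injective
    rw [QuaternionGroup.eq_a_of_involution (g := e ⟨a, haP⟩)
        (by rw [← map_mul, hs a ha, map_one]) ((map_ne_one_iff e e.injective).2 (hne a ha' haP)),
      QuaternionGroup.eq_a_of_involution (g := e ⟨b, hbP⟩)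
        (by rw [← map_mul, hs b hb, map_one]) ((map_ne_one_iff e e.injective).2 (hne b hb' hbP))]

theorem exists_involution_of_odd_orbit {G : Type*} [Group G] [Finite G] {H : Subgroup G}
    {T : Set G} (hT : T⁻¹ = T) (hHT : Subgroup.IsComplement (H : Set G) T) {x : G}
    (hx : x * x ∈ H) (hodd : Odd (orbit H (x : G ⧸ H)).ncard) :
    ∃ y : G, (y : G ⧸ H) ∈ orbit H (x : G ⧸ H) ∧ y * y = 1 := by
  rw [isComplement_iff_existsUnique_mk_of_inv_eq hT] at hHT
  have horb : orbit H ((x⁻¹ : G) : G ⧸ H) = orbit H (x : G ⧸ H) :=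
    orbit_eq_iff.2 (mk_mem_orbit_iff.2 ⟨1, H.one_mem, (x * x)⁻¹, H.inv_mem hx, by group⟩)
  let S := {t : G // t ∈ T ∧ (t : G ⧸ H) ∈ orbit H (x : G ⧸ H)}
  let f : S → S := fun t => ⟨(t : G)⁻¹, hT.subset (Set.inv_mem_inv.2 t.2.1),
    horb.subset (mk_inv_mem_orbit_inv t.2.2)⟩
  have hf : Function.Involutive f := fun t => Subtype.ext (inv_inv _)
  have hcard : Nat.card S = (orbit H (x : G ⧸ H)).ncard := by
    rw [← Nat.card_coe_set_eq]
    refine Nat.card_eq_of_bijective (fun t : S => (⟨(t : G), t.2.2⟩ : orbit H (x : G ⧸ H)))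
      ⟨fun s t hst => ?_, fun q => ?_⟩
    · exact Subtype.ext ((hHT (s.1 : G ⧸ H)).unique ⟨s.2.1, rfl⟩
        ⟨t.2.1, (congrArg Subtype.val hst).symm⟩)
    · obtain ⟨t, ⟨ht, htq⟩, -⟩ := hHT q
      exact ⟨⟨t, ht, htq ▸ q.2⟩, Subtype.ext htq⟩
  have hmod := hf.card_modEq_card_fixedPoints
  rw [hcard] at hmod
  have hpos : Nat.card (Function.fixedPoints f) ≠ 0 := by
    intro h0
    rw [h0] at hmod
    exact hodd.not_two_dvd_nat (Nat.modEq_zero_iff_dvd.1 hmod)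
  obtain ⟨⟨⟨t, ht⟩, htf⟩⟩ := (Nat.card_ne_zero.1 hpos).1
  refine ⟨t, ht.2, ?_⟩
  have : t⁻¹ = t := congrArg Subtype.val htf
  nth_rewrite 1 [← this]
  exact inv_mul_cancel t

theorem stmt_11 {G : Type*} [Group G] [Fintype G]
    (hSyl : ∀ P : Sylow 2 G, IsCyclic P ∨
      ∃ n : ℕ, 1 ≤ n ∧ Nonempty (P ≃* QuaternionGroup (2 ^ n)))
    (H : Subgroup G) :
    (∃ T : Set G, Subgroup.IsComplement (H : Set G) T ∧ T⁻¹ = T) ↔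
      Odd (Nat.card H) ∨ Odd H.index := by
  constructor
  · rintro ⟨T, hHT, hT⟩
    by_contra! hcon
    obtain ⟨hcard, hindex⟩ := hcon
    rw [Nat.not_odd_iff_even] at hcard hindex
    obtain ⟨x, hxH, hx, hodd⟩ := exists_sq_mem_odd_orbit hindex
    obtain ⟨y, hyx, hy⟩ := exists_involution_of_odd_orbit hT hHT hx hodd
    have hyH : y ∉ H := by
      intro hyH
      obtain ⟨h, hh, k, hk, rfl⟩ := mk_mem_orbit_iff.1 hyx
      exact hxH ((H.mul_mem_cancel_left hh).1 ((H.mul_mem_cancel_right hk).1 hyH))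
    rw [← orbit_eq_iff.2 hyx, ← index_stabilizer] at hodd
    have hinv : y⁻¹ = y := inv_eq_of_mul_eq_one_left hy
    let K : Subgroup G := (stabilizer H (y : G ⧸ H)).map H.subtype
    have hK : Even (Nat.card K) := by
      rw [Subgroup.card_map_of_injective H.subtype_injective]
      rw [← (stabilizer H (y : G ⧸ H)).card_mul_index, Nat.even_mul] at hcard
      exact hcard.resolve_right (Nat.not_even_iff_odd.2 hodd)
    obtain ⟨t, htK, ht1, ht, hty⟩ := exists_commute_involution hK hy (by
      rintro _ ⟨k, hk, rfl⟩
      have hk' := mem_stabilizer_mk_iff.1 hk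
      rw [hinv] at hk'
      refine ⟨⟨y * k * y, hk'⟩, mem_stabilizer_mk_iff.2 ?_, rfl⟩
      rw [hinv]
      change y * (y * k * y) * y ∈ H
      rw [show y * (y * k * y) * y = (y * y) * k * (y * y) by group, hy, one_mul, mul_one]
      exact k.2)
    have hytH := commuting_involutions_eq hSyl hy (fun h => hyH (h ▸ H.one_mem)) ht ht1 hty
    exact hyH (hytH ▸ Subgroup.map_subtype_le _ htK)
  · rintro (hH | hH)
    · exact exists_isComplement_inv_eq fun x hx _ =>
        exists_mk_eq_mul_self_eq_one_of_odd_card hH hx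
    · refine exists_isComplement_inv_eq fun x hx hodd => ⟨1, ?_, one_mul 1⟩
      exact QuotientGroup.eq.2 (by simpa using mem_of_odd_index_of_odd_orbit hH hx hodd)
end

section
/- Let G be a finite solvable group of odd order with exactly |π(G)| conjugacy classes of nontrivial proper subgroup perfect codes. Then |G| = p·q for distinct odd primes p < q, and G ≅ ℤ_q ⋊ ℤ_p. -/
open Pointwise

/-- `H` is a subgroup perfect code of `G`: it admits an inverse-closed right transversal. -/
def IsPerfectCode {G : Type*} [Group G] (H : Subgroup G) : Prop :=
  ∃ T : Set G, Subgroup.IsComplement (H : Set G) T ∧ T⁻¹ = T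

/-- The nontrivial proper subgroup perfect codes of `G`. -/
def NontrivialProperPerfectCode (G : Type*) [Group G] : Type _ :=
  {H : Subgroup G // H ≠ ⊥ ∧ H ≠ ⊤ ∧ IsPerfectCode H}

/-- Conjugacy classes of nontrivial proper subgroup perfect codes of `G`. -/
def PerfectCodeConjClasses (G : Type*) [Group G] : Type _ :=
  Quot (fun H K : NontrivialProperPerfectCode G => ∃ g : G, MulAut.conj g • H.1 = K.1)

/-- In a finite group of odd order, an element whose square lies in a subgroup lies in it. -/
theorem Subgroup.mem_of_sq_mem_of_odd_card {G : Type*} [Group G] (hodd : Odd (Nat.card G))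
    {H : Subgroup G} {x : G} (hx : x ^ 2 ∈ H) : x ∈ H := by
  obtain ⟨k, hk⟩ := hodd
  have hone : x ^ (2 * k + 1) = 1 := hk ▸ pow_card_eq_one'
  have hinv : x = ((x ^ 2) ^ k)⁻¹ := by
    rw [eq_inv_iff_mul_eq_one, ← pow_mul, ← pow_succ', hone]
  rw [hinv]
  exact H.inv_mem (H.pow_mem hx k)

/-- `T` is an inverse-closed set of representatives for some of the right cosets of `H`,
including `H` itself. -/
structure IsPartialSymmTransversal {G : Type*} [Group G] (H : Subgroup G) (T : Set G) :
    Prop where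
  one_mem : 1 ∈ T
  inv_mem : ∀ t ∈ T, t⁻¹ ∈ T
  eq_of_mul_inv_mem : ∀ s ∈ T, ∀ t ∈ T, s * t⁻¹ ∈ H → s = t

namespace IsPartialSymmTransversal

variable {G : Type*} [Group G] {H : Subgroup G} {T : Set G}

theorem singleton_one : IsPartialSymmTransversal H {1} where
  one_mem := rfl
  inv_mem := by simp
  eq_of_mul_inv_mem := by simp

/-- A partial inverse-closed transversal can be enlarged by a new pair of inverse elements
representing two distinct new cosets. -/
theorem insert_pair (hT : IsPartialSymmTransversal H T) {x : G}
    (hx : ∀ t ∈ T, x * t⁻¹ ∉ H) (hx' : ∀ t ∈ T, x⁻¹ * t⁻¹ ∉ H) (hne : x ^ 2 ∉ H) :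
    IsPartialSymmTransversal H (T ∪ {x, x⁻¹}) where
  one_mem := Or.inl hT.one_mem
  inv_mem := by
    rintro t (ht | rfl | rfl)
    · exact Or.inl (hT.inv_mem t ht)
    · exact Or.inr (Or.inr rfl)
    · exact Or.inr (Or.inl (inv_inv x))
  eq_of_mul_inv_mem := by
    have hsymm : ∀ a b : G, a * b⁻¹ ∈ H → b * a⁻¹ ∈ H := fun a b h => by
      simpa using H.inv_mem h
    rintro s (hs | rfl | rfl) t (ht | rfl | rfl) h
    · exact hT.eq_of_mul_inv_mem s hs t ht h
    · exact absurd (hsymm _ _ h) (hx s hs)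
    · exact absurd (hsymm _ _ h) (hx' s hs)
    · exact absurd h (hx t ht)
    · rfl
    · exact absurd (by simpa [sq] using h) hne
    · exact absurd h (hx' t ht)
    · exact absurd (by simpa [sq] using hsymm _ _ h) hne
    · rfl

/-- If `T` misses a right coset contained in the double coset `H x H`, then it also misses one
contained in `H x⁻¹ H`. -/
theorem exists_forall_mul_inv_notMem [Finite G] (hT : IsPartialSymmTransversal H T) {x : G}
    (hx : ∀ t ∈ T, x * t⁻¹ ∉ H) :
    ∃ y ∈ DoubleCoset.doubleCoset x⁻¹ (H : Set G) H, ∀ t ∈ T, y * t⁻¹ ∉ H := by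
  by_contra! hcov
  let D := DoubleCoset.doubleCoset x (H : Set G) H
  let D' := DoubleCoset.doubleCoset x⁻¹ (H : Set G) H
  have hDD' : ∀ g ∈ D', g⁻¹ ∈ D := by
    intro g hg
    obtain ⟨a, ha, b, hb, rfl⟩ := DoubleCoset.mem_doubleCoset.1 hg
    exact DoubleCoset.mem_doubleCoset.2
      ⟨b⁻¹, H.inv_mem hb, a⁻¹, H.inv_mem ha, by group⟩
  have hD'D : ∀ g ∈ D, g⁻¹ ∈ D' := by
    intro g hg
    obtain ⟨a, ha, b, hb, rfl⟩ := DoubleCoset.mem_doubleCoset.1 hg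
    exact DoubleCoset.mem_doubleCoset.2
      ⟨b⁻¹, H.inv_mem hb, a⁻¹, H.inv_mem ha, by group⟩
  have hmul : ∀ h ∈ H, ∀ g ∈ D, h * g ∈ D := by
    intro h hh g hg
    obtain ⟨a, ha, b, hb, rfl⟩ := DoubleCoset.mem_doubleCoset.1 hg
    exact DoubleCoset.mem_doubleCoset.2 ⟨h * a, H.mul_mem hh ha, b, hb, by group⟩
  have hmul' : ∀ h ∈ H, ∀ g ∈ D', h * g ∈ D' := by
    intro h hh g hg
    obtain ⟨a, ha, b, hb, rfl⟩ := DoubleCoset.mem_doubleCoset.1 hg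
    exact DoubleCoset.mem_doubleCoset.2 ⟨h * a, H.mul_mem hh ha, b, hb, by group⟩
  choose! r hrT hrH using hcov
  have hrD' : ∀ g ∈ D', r g ∈ D' := by
    intro g hg
    have := hmul' _ (H.inv_mem (hrH g hg)) g hg
    simpa using this
  -- sends `h * t` with `t ∈ T` to `h * t⁻¹`
  let F : D' → D := fun g =>
    ⟨(g : G) * (r g)⁻¹ * (r g)⁻¹, hmul _ (hrH g g.2) _ (hDD' _ (hrD' g g.2))⟩
  have hF : Function.Injective F := by
    intro g k hgk
    have h := congrArg Subtype.val hgk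
    simp only [F] at h
    have hr : (r g)⁻¹ = (r k)⁻¹ := by
      refine hT.eq_of_mul_inv_mem _ (hT.inv_mem _ (hrT g g.2)) _
        (hT.inv_mem _ (hrT k k.2)) ?_
      have : (r g)⁻¹ * (r k)⁻¹⁻¹ = ((g : G) * (r g)⁻¹)⁻¹ * (k * (r k)⁻¹) := by
        rw [eq_inv_mul_iff_mul_eq, ← mul_assoc, h]
        simp
      rw [this]
      exact H.mul_mem (H.inv_mem (hrH g g.2)) (hrH k k.2)
    rw [hr] at h
    exact Subtype.ext (mul_right_cancel (mul_right_cancel h))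
  let e : D ≃ D' :=
    ⟨fun g => ⟨(g : G)⁻¹, hD'D _ g.2⟩, fun g => ⟨(g : G)⁻¹, hDD' _ g.2⟩,
      fun g => by simp, fun g => by simp⟩
  have hsurj : Function.Surjective F :=
    ((Nat.bijective_iff_injective_and_card F).2 ⟨hF, (Nat.card_congr e).symm⟩).2
  obtain ⟨g, hg⟩ := hsurj ⟨x, DoubleCoset.mem_doubleCoset_self H H x⟩
  have h := congrArg Subtype.val hg
  simp only [F] at h
  refine hx (r g)⁻¹ (hT.inv_mem _ (hrT g g.2)) ?_
  rw [← h]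
  simpa using hrH g g.2

end IsPartialSymmTransversal

/-- Every subgroup of a finite group of odd order is a perfect code. -/
theorem isPerfectCode_of_odd_card {G : Type*} [Group G] [Finite G] (hodd : Odd (Nat.card G))
    (H : Subgroup G) : IsPerfectCode H := by
  obtain ⟨T, hmax⟩ := (Set.toFinite {T : Set G | IsPartialSymmTransversal H T}).exists_maximal
    ⟨_, IsPartialSymmTransversal.singleton_one⟩
  have hT : IsPartialSymmTransversal H T := hmax.prop
  have hcov : ∀ x, ∃ t ∈ T, x * t⁻¹ ∈ H := by
    by_contra! hcon
    obtain ⟨x, hx⟩ := hcon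
    obtain ⟨y, hy, hyT⟩ := hT.exists_forall_mul_inv_notMem hx
    obtain ⟨a, ha, b, hb, rfl⟩ := DoubleCoset.mem_doubleCoset.1 hy
    have hxH : x ∉ H := by simpa using hx 1 hT.one_mem
    have hzx : ∀ t ∈ T, b⁻¹ * x * t⁻¹ ∉ H := by
      intro t ht h
      rw [mul_assoc, H.mul_mem_cancel_left (H.inv_mem hb)] at h
      exact hx t ht h
    refine hzx (b⁻¹ * x) (hmax.2 (hT.insert_pair hzx ?_ ?_) Set.subset_union_left
      (Or.inr (Or.inl rfl))) (by simp)
    · intro t ht h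
      refine hyT t ht ?_
      have := H.mul_mem ha h
      simpa [mul_assoc] using this
    · intro h
      have := Subgroup.mem_of_sq_mem_of_odd_card hodd h
      exact hxH ((H.mul_mem_cancel_left (H.inv_mem hb)).1 this)
  refine ⟨T, Subgroup.isComplement_iff_existsUnique_mul_inv_mem.2 fun g => ?_, ?_⟩
  · obtain ⟨t, ht, hg⟩ := hcov g
    refine ⟨⟨t, ht⟩, hg, ?_⟩
    rintro ⟨s, hs⟩ hgs
    refine Subtype.ext (hT.eq_of_mul_inv_mem s hs t ht ?_)
    have := H.mul_mem (H.inv_mem hgs) hg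
    simpa [mul_assoc] using this
  · ext t
    exact ⟨fun h => by simpa using hT.inv_mem _ h, fun h => hT.inv_mem t h⟩

/-- The common order of the members of a conjugacy class of perfect codes. -/
noncomputable def PerfectCodeConjClasses.order {G : Type*} [Group G] :
    PerfectCodeConjClasses G → ℕ :=
  Quot.lift (fun H => Nat.card H.1) fun H K ⟨g, hg⟩ => by
    rw [← hg]
    exact Nat.card_congr (Subgroup.equivSMul (MulAut.conj g) H.1).toEquiv

theorem Nat.ne_of_primeFactors_subset_singleton {n m p : ℕ} (hn : 2 ≤ n.primeFactors.card)
    (hm : m.primeFactors ⊆ {p}) : m ≠ n := by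
  rintro rfl
  have := Finset.card_le_card hm
  rw [Finset.card_singleton] at this
  omega

section

variable {G : Type*} [Group G] [Finite G]

/-- In a group of odd order with exactly `|π(G)| ≥ 2` classes of nontrivial proper subgroup
perfect codes, every nontrivial proper subgroup has the order of a Sylow subgroup. -/
theorem exists_card_eq_ordProj (hodd : Odd (Nat.card G))
    (hpi : 2 ≤ (Nat.card G).primeFactors.card)
    (heq : Nat.card (PerfectCodeConjClasses G) = (Nat.card G).primeFactors.card)
    (H : Subgroup G) (hbot : H ≠ ⊥) (htop : H ≠ ⊤) :
    ∃ p ∈ (Nat.card G).primeFactors, Nat.card H = p ^ (Nat.card G).factorization p := by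
  have : Finite (NontrivialProperPerfectCode G) :=
    inferInstanceAs (Finite {H : Subgroup G // H ≠ ⊥ ∧ H ≠ ⊤ ∧ IsPerfectCode H})
  have : Finite (PerfectCodeConjClasses G) := inferInstanceAs (Finite (Quot _))
  have hsyl : ∀ p : (Nat.card G).primeFactors, ∃ c : PerfectCodeConjClasses G,
      c.order = (p : ℕ) ^ (Nat.card G).factorization p := by
    rintro ⟨p, hp⟩
    have hpp : p.Prime := Nat.prime_of_mem_primeFactors hp
    have : Fact p.Prime := ⟨hpp⟩
    obtain ⟨P⟩ : Nonempty (Sylow p G) := inferInstance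
    have hP := P.card_eq_multiplicity
    have hpos := hpp.factorization_pos_of_dvd Nat.card_pos.ne' (Nat.dvd_of_mem_primeFactors hp)
    refine ⟨Quot.mk _ ⟨P, ?_, ?_, isPerfectCode_of_odd_card hodd _⟩, hP⟩
    · intro h
      rw [h, Subgroup.card_bot] at hP
      exact (Nat.one_lt_pow hpos.ne' hpp.one_lt).ne hP
    · intro h
      rw [h, Subgroup.card_top] at hP
      exact Nat.ne_of_primeFactors_subset_singleton hpi
        (Nat.primeFactors_prime_pow hpos.ne' hpp).subset hP.symm
  choose f hf using hsyl
  have hinj : Function.Injective f := by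
    rintro ⟨p, hp⟩ ⟨q, hq⟩ h
    have hpq := (hf ⟨p, hp⟩).symm.trans ((congrArg _ h).trans (hf ⟨q, hq⟩))
    have hpp : p.Prime := Nat.prime_of_mem_primeFactors hp
    have hpos := hpp.factorization_pos_of_dvd Nat.card_pos.ne' (Nat.dvd_of_mem_primeFactors hp)
    have hdvd : p ∣ q ^ (Nat.card G).factorization q :=
      (dvd_pow_self p hpos.ne').trans (dvd_of_eq hpq)
    exact Subtype.ext ((Nat.prime_dvd_prime_iff_eq hpp
      (Nat.prime_of_mem_primeFactors hq)).1 (hpp.dvd_of_dvd_pow hdvd))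
  have hbij := (Nat.bijective_iff_injective_and_card f).2 ⟨hinj,
    (Nat.card_eq_finsetCard _).trans heq.symm⟩
  obtain ⟨p, hp⟩ := hbij.2 (Quot.mk _ ⟨H, hbot, htop, isPerfectCode_of_odd_card hodd H⟩)
  exact ⟨p, p.2, by rw [← hf p, hp]; rfl⟩

/-- In a group whose order has at least two prime factors, subgroups of prime order are
nontrivial and proper. -/
theorem Subgroup.ne_bot_and_ne_top_of_card_prime {G : Type*} [Group G]
    (hpi : 2 ≤ (Nat.card G).primeFactors.card)
    {H : Subgroup G} (hH : (Nat.card H).Prime) : H ≠ ⊥ ∧ H ≠ ⊤ := by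
  constructor
  · rintro rfl
    exact Nat.not_prime_one (by simpa using hH)
  · rintro rfl
    exact Nat.ne_of_primeFactors_subset_singleton hpi hH.primeFactors.subset
      (Subgroup.card_top (G := G))

theorem Subgroup.exists_card_eq_prime {p : ℕ} (hp : p ∈ (Nat.card G).primeFactors) :
    ∃ K : Subgroup G, Nat.card K = p := by
  have : Fact p.Prime := ⟨Nat.prime_of_mem_primeFactors hp⟩
  obtain ⟨x, hx⟩ := exists_prime_orderOf_dvd_card' p (Nat.dvd_of_mem_primeFactors hp)
  exact ⟨Subgroup.zpowers x, by rw [Nat.card_zpowers, hx]⟩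

/-- If every nontrivial proper subgroup has the order of a Sylow subgroup, then every nontrivial
proper subgroup has prime order. -/
theorem card_prime_of_exists_card_eq_ordProj (hpi : 2 ≤ (Nat.card G).primeFactors.card)
    (hcard : ∀ H : Subgroup G, H ≠ ⊥ → H ≠ ⊤ →
      ∃ p ∈ (Nat.card G).primeFactors, Nat.card H = p ^ (Nat.card G).factorization p)
    (H : Subgroup G) (hbot : H ≠ ⊥) (htop : H ≠ ⊤) : (Nat.card H).Prime := by
  obtain ⟨p, hp, hH⟩ := hcard H hbot htop
  have hpp : p.Prime := Nat.prime_of_mem_primeFactors hp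
  obtain ⟨K, hK⟩ := Subgroup.exists_card_eq_prime hp
  obtain ⟨hKbot, hKtop⟩ := Subgroup.ne_bot_and_ne_top_of_card_prime hpi (hK ▸ hpp)
  obtain ⟨r, hr, hKr⟩ := hcard K hKbot hKtop
  rw [hK] at hKr
  have hpr : p = r := (Nat.prime_dvd_prime_iff_eq hpp (Nat.prime_of_mem_primeFactors hr)).1
    (hpp.dvd_of_dvd_pow (dvd_of_eq hKr))
  subst hpr
  rwa [hH, ← hKr]

/-- A solvable group with a nontrivial proper subgroup has a nontrivial proper normal subgroup. -/
theorem exists_normal_ne_bot_ne_top {G : Type*} [Group G] [Group.IsSolvable G]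
    {P : Subgroup G} (hbot : P ≠ ⊥) (htop : P ≠ ⊤) :
    ∃ N : Subgroup G, N.Normal ∧ N ≠ ⊥ ∧ N ≠ ⊤ := by
  by_contra! h
  have : Nontrivial G := by
    obtain ⟨x, hx⟩ := P.ne_bot_iff_exists_ne_one.1 hbot
    exact ⟨x, 1, fun h => hx (Subtype.ext h)⟩
  have : IsSimpleGroup G :=
    ⟨fun N hN => or_iff_not_imp_left.2 (h N hN)⟩
  have hcomm := IsSimpleGroup.comm_iff_isSolvable.2 ‹Group.IsSolvable G›
  refine htop (h P ⟨fun n hn g => ?_⟩ hbot)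
  rwa [hcomm g n, mul_inv_cancel_right]

/-- A finite solvable group whose order has at least two prime factors and all of whose nontrivial
proper subgroups have prime order has order a product of two distinct primes. -/
theorem card_eq_mul_of_forall_card_prime [Group.IsSolvable G]
    (hpi : 2 ≤ (Nat.card G).primeFactors.card)
    (hprime : ∀ H : Subgroup G, H ≠ ⊥ → H ≠ ⊤ → (Nat.card H).Prime) :
    ∃ p q : ℕ, p.Prime ∧ q.Prime ∧ p ≠ q ∧ Nat.card G = p * q := by
  have hexists : ∀ q, ∃ p ∈ (Nat.card G).primeFactors, p ≠ q := fun q =>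
    Finset.exists_mem_ne hpi q
  obtain ⟨r, hr, -⟩ := hexists 0
  obtain ⟨R, hR⟩ := Subgroup.exists_card_eq_prime hr
  obtain ⟨hRbot, hRtop⟩ := Subgroup.ne_bot_and_ne_top_of_card_prime hpi
    (hR ▸ Nat.prime_of_mem_primeFactors hr)
  obtain ⟨N, hN, hNbot, hNtop⟩ := exists_normal_ne_bot_ne_top hRbot hRtop
  have hq := hprime N hNbot hNtop
  obtain ⟨p, hp, hpq⟩ := hexists (Nat.card N)
  have hpp : p.Prime := Nat.prime_of_mem_primeFactors hp
  obtain ⟨K, hK⟩ := Subgroup.exists_card_eq_prime hp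
  have hsup : K ⊔ N = ⊤ := by
    by_contra htop
    have hs := hprime (K ⊔ N) (fun h => hNbot (eq_bot_mono le_sup_right h)) htop
    have h1 := (Nat.prime_dvd_prime_iff_eq hpp hs).1
      (hK ▸ Subgroup.card_dvd_of_le le_sup_left)
    have h2 := (Nat.prime_dvd_prime_iff_eq hq hs).1 (Subgroup.card_dvd_of_le le_sup_right)
    exact hpq (h1.trans h2.symm)
  have hcompl : Subgroup.IsComplement' K N := by
    refine Subgroup.isComplement'_of_disjoint_and_mul_eq_univ ?_ ?_
    · refine Subgroup.disjoint_of_coprime_natCard ?_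
      rw [hK]
      exact (Nat.coprime_primes hpp hq).2 hpq
    · rw [← Subgroup.mul_normal, hsup, Subgroup.coe_top]
  exact ⟨p, Nat.card N, hpp, hq, hpq, by rw [← hcompl.card_mul_card, hK]⟩

/-- A group of order `p * q` with `p < q` primes is a semidirect product of `ℤ/q` by `ℤ/p`. -/
theorem exists_mulEquiv_semidirectProduct_zmod {p q : ℕ} (hp : p.Prime) (hq : q.Prime)
    (hpq : p < q) (hG : Nat.card G = p * q) :
    ∃ φ : Multiplicative (ZMod p) →* MulAut (Multiplicative (ZMod q)),
      Nonempty (G ≃* (Multiplicative (ZMod q)) ⋊[φ] (Multiplicative (ZMod p))) := by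
  have : Fact p.Prime := ⟨hp⟩
  have : Fact q.Prime := ⟨hq⟩
  have hne : (Nat.card G) ≠ 0 := Nat.card_pos.ne'
  obtain ⟨P, hP⟩ := Subgroup.exists_card_eq_prime
    (Nat.mem_primeFactors.2 ⟨hp, hG ▸ dvd_mul_right p q, hne⟩)
  obtain ⟨Q⟩ : Nonempty (Sylow q G) := inferInstance
  have hQ : Nat.card Q = q := by
    rw [Q.card_eq_multiplicity, hG, Nat.factorization_mul hp.ne_zero hq.ne_zero,
      hp.factorization, hq.factorization]
    simp [hpq.ne]
  have hindex : (Q : Subgroup G).index = p := by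
    have h := (Q : Subgroup G).card_mul_index
    rw [hG, mul_comm p q] at h
    have hQ' : Nat.card (Q : Subgroup G) = q := hQ
    rw [hQ'] at h
    exact Nat.eq_of_mul_eq_mul_left hq.pos h
  have hone : Nat.card (Sylow q G) = 1 := by
    have hmod := card_sylow_modEq_one q G
    have hle : Nat.card (Sylow q G) ≤ p :=
      Nat.le_of_dvd hp.pos (hindex ▸ Q.card_dvd_index)
    exact Nat.ModEq.eq_of_lt_of_lt hmod (hle.trans_lt hpq) hq.one_lt
  have : Subsingleton (Sylow q G) := (Nat.card_eq_one_iff_unique.1 hone).1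
  have hnormal : (Q : Subgroup G).Normal := Q.normal_of_subsingleton
  have hcompl : Subgroup.IsComplement' (Q : Subgroup G) P := by
    refine Subgroup.isComplement'_of_coprime ?_ ?_
    · rw [hP, hG, mul_comm p q]
      exact congrArg (· * p) hQ
    · rw [hP]
      exact hQ.symm ▸ (Nat.coprime_primes hq hp).2 hpq.ne'
  let eQ : (Q : Subgroup G) ≃* Multiplicative (ZMod q) :=
    mulEquivOfPrimeCardEq (p := q) hQ (by simp)
  let eP : P ≃* Multiplicative (ZMod p) := mulEquivOfPrimeCardEq (p := p) hP (by simp)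
  exact ⟨_, ⟨(SemidirectProduct.mulEquivSubgroup hcompl).symm.trans
    (SemidirectProduct.congr' eQ eP)⟩⟩

end

theorem stmt_16 {G : Type*} [Group G] [Fintype G] (hsol : IsSolvable G)
    (hodd : Odd (Nat.card G)) (hpi : 2 ≤ (Nat.card G).primeFactors.card)
    (heq : Nat.card (PerfectCodeConjClasses G) = (Nat.card G).primeFactors.card) :
    ∃ p q : ℕ, p.Prime ∧ q.Prime ∧ Odd p ∧ Odd q ∧ p < q ∧ Nat.card G = p * q ∧
      ∃ φ : Multiplicative (ZMod p) →* MulAut (Multiplicative (ZMod q)),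
        Nonempty (G ≃* (Multiplicative (ZMod q)) ⋊[φ] (Multiplicative (ZMod p))) := by
  have : Group.IsSolvable G := hsol
  obtain ⟨p, q, hp, hq, hpq, hG⟩ := card_eq_mul_of_forall_card_prime hpi
    (card_prime_of_exists_card_eq_ordProj hpi (exists_card_eq_ordProj hodd hpi heq))
  wlog hlt : p < q generalizing p q
  · exact this q p hq hp hpq.symm (hG.trans (mul_comm p q)) (hpq.lt_or_gt.resolve_left hlt)
  exact ⟨p, q, hp, hq, hodd.of_dvd_nat (hG ▸ dvd_mul_right p q),
    hodd.of_dvd_nat (hG ▸ dvd_mul_left q p), hlt, hG,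
    exists_mulEquiv_semidirectProduct_zmod hp hq hlt hG⟩
end
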